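/- Let k be a field, V a finite-dimensional k-vector space, N ≥ 2 an integer, and R ⊆ V^{⊗N} a subspace. For each n, let τ_n : V^{⊗n} → V^{⊗n} be the linear automorphism determined by τ_n(v_1⊗v_2⊗⋯⊗v_n) = v_n⊗⋯⊗v_2⊗v_1. Say that a subspace S ⊆ V^{⊗N} satisfies the extra condition if (V^{⊗(N-1)}⊗S) ∩ (Σ_{i=0}^{N-2} V^{⊗i}⊗S⊗V^{⊗(N-1-i)}) = V^{⊗(N-2)}⊗((V⊗S)∩(S⊗V)) as subspaces of V^{⊗(2N-1)}. Then R satisfies the extra condition if and only if τ_N(R) satisfies the extra condition. -/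

import Mathlib

/-- The degree-`n` component `V^{⊗n}` of the tensor algebra of `V`, realized as the
`n`-th power of the image of `V` in `T(V)`.  Via the canonical identification of the
tensor algebra with `⊕ₙ V^{⊗n}`, a subspace of `V^{⊗n}` is a submodule of `T(V)`
contained in `tpow k V n`, and the tensor product of subspaces corresponds to the
multiplication of submodules of the algebra `T(V)`; pure tensors correspond to
products of elements of the image of `V`. -/
noncomputable def tpow (k V : Type*) [CommSemiring k] [AddCommMonoid V] [Module k V]
    (n : ℕ) : Submodule k (TensorAlgebra k V) :=
  (LinearMap.range (TensorAlgebra.ι k (M := V))) ^ n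

/-- A subspace `S ⊆ V^{⊗N}` satisfies the *extra condition* if
`(V^{⊗(N-1)}⊗S) ∩ (Σ_{i=0}^{N-2} V^{⊗i}⊗S⊗V^{⊗(N-1-i)})
  = V^{⊗(N-2)}⊗((V⊗S)∩(S⊗V))` as subspaces of `V^{⊗(2N-1)}`. -/
def ExtraCondition (k V : Type*) [CommSemiring k] [AddCommMonoid V] [Module k V]
    (N : ℕ) (S : Submodule k (TensorAlgebra k V)) : Prop :=
  (tpow k V (N - 1) * S) ⊓
      (⨆ i ∈ Finset.range (N - 1), tpow k V i * S * tpow k V (N - 1 - i))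
    = tpow k V (N - 2) * ((tpow k V 1 * S) ⊓ (S * tpow k V 1))

section LeftMultiplication

open TensorAlgebra

variable {k V : Type*} [Field k] [AddCommGroup V] [Module k V]

/-- The action of `T(V)` on `T(V) × T(V)` in which `v : V` sends `(a, b)` to `(v * a, φ v • a)`. -/
noncomputable def stripAction (φ : V →ₗ[k] k) :
    TensorAlgebra k V →ₐ[k] Module.End k (TensorAlgebra k V × TensorAlgebra k V) :=
  lift k (LinearMap.mk₂ k
    (fun (v : V) (p : TensorAlgebra k V × TensorAlgebra k V) => (ι k v * p.1, φ v • p.1))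
    (fun v w p => by simp [add_mul, add_smul])
    (fun c v p => by simp [mul_smul])
    (fun v p q => by simp [mul_add])
    (fun c v p => by simp only [Prod.smul_fst, mul_smul_comm, smul_comm (φ v) c, Prod.smul_mk]))

theorem stripAction_ι (φ : V →ₗ[k] k) (v : V) (p : TensorAlgebra k V × TensorAlgebra k V) :
    stripAction φ (ι k v) p = (ι k v * p.1, φ v • p.1) := by
  simp [stripAction]

theorem stripAction_fst (φ : V →ₗ[k] k) (x : TensorAlgebra k V)
    (p : TensorAlgebra k V × TensorAlgebra k V) : (stripAction φ x p).1 = x * p.1 := by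
  induction x using TensorAlgebra.induction generalizing p with
  | algebraMap r => simp [Module.algebraMap_end_apply, Algebra.smul_def]
  | ι v => simp [stripAction_ι]
  | mul a b ha hb => simp [ha, hb, mul_assoc]
  | add a b ha hb => simp [ha, hb, add_mul]

/-- The linear endomorphism of `T(V)` stripping the leftmost factor `v` of a tensor and replacing
it by the scalar `φ v`. -/
noncomputable def stripLeft (φ : V →ₗ[k] k) : TensorAlgebra k V →ₗ[k] TensorAlgebra k V :=
  LinearMap.snd k _ _ ∘ₗ LinearMap.applyₗ (1, 0) ∘ₗ (stripAction φ).toLinearMap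

theorem stripLeft_ι_mul (φ : V →ₗ[k] k) (v : V) (x : TensorAlgebra k V) :
    stripLeft φ (ι k v * x) = φ v • x := by
  simp [stripLeft, stripAction_ι, stripAction_fst]

theorem stripLeft_mem_of_mem_range_ι_mul {X : Submodule k (TensorAlgebra k V)}
    {z : TensorAlgebra k V} (hz : z ∈ LinearMap.range (ι k (M := V)) * X) (φ : V →ₗ[k] k) :
    stripLeft φ z ∈ X := by
  induction hz using Submodule.mul_induction_on' with
  | mem_mul_mem a ha x hx =>
    obtain ⟨v, rfl⟩ := ha
    rw [stripLeft_ι_mul]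
    exact X.smul_mem _ hx
  | add a _ b _ ha hb => rw [map_add]; exact X.add_mem ha hb

theorem sum_ι_mul_stripLeft [FiniteDimensional k V] {X : Submodule k (TensorAlgebra k V)}
    {z : TensorAlgebra k V} (hz : z ∈ LinearMap.range (ι k (M := V)) * X) :
    ∑ i, ι k (Module.finBasis k V i) * stripLeft ((Module.finBasis k V).coord i) z = z := by
  induction hz using Submodule.mul_induction_on' with
  | mem_mul_mem a ha x hx =>
    obtain ⟨v, rfl⟩ := ha
    conv_rhs => rw [← (Module.finBasis k V).sum_repr v, map_sum, Finset.sum_mul]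
    simp [stripLeft_ι_mul]
  | add a _ b _ ha hb =>
    simp only [map_add, mul_add, Finset.sum_add_distrib, ha, hb]

theorem range_ι_mul_inf [FiniteDimensional k V] (X Y : Submodule k (TensorAlgebra k V)) :
    LinearMap.range (ι k (M := V)) * (X ⊓ Y) =
      LinearMap.range (ι k (M := V)) * X ⊓ LinearMap.range (ι k (M := V)) * Y := by
  refine le_antisymm
    (le_inf (mul_le_mul_right inf_le_left _) (mul_le_mul_right inf_le_right _)) ?_
  rintro z ⟨hX, hY⟩
  rw [← sum_ι_mul_stripLeft hX]
  exact Submodule.sum_mem _ fun i _ => Submodule.mul_mem_mul ⟨_, rfl⟩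
    ⟨stripLeft_mem_of_mem_range_ι_mul hX _, stripLeft_mem_of_mem_range_ι_mul hY _⟩

theorem le_of_range_ι_mul_le [Nontrivial V] {X Y : Submodule k (TensorAlgebra k V)}
    (h : LinearMap.range (ι k (M := V)) * X ≤ LinearMap.range (ι k (M := V)) * Y) : X ≤ Y := by
  intro x hx
  obtain ⟨v, hv⟩ := exists_ne (0 : V)
  obtain ⟨φ, hφ⟩ := Module.Projective.exists_dual_ne_zero k hv
  have hmem := stripLeft_mem_of_mem_range_ι_mul
    (h (Submodule.mul_mem_mul (LinearMap.mem_range_self _ v) hx)) φ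
  rw [stripLeft_ι_mul] at hmem
  exact (Submodule.smul_mem_iff _ hφ).1 hmem

theorem le_of_range_ι_pow_mul_le [Nontrivial V] (d : ℕ) {X Y : Submodule k (TensorAlgebra k V)}
    (h : LinearMap.range (ι k (M := V)) ^ d * X ≤ LinearMap.range (ι k (M := V)) ^ d * Y) :
    X ≤ Y := by
  induction d with
  | zero => simpa using h
  | succ d ih =>
    refine ih (le_of_range_ι_mul_le ?_)
    simpa only [← mul_assoc, ← pow_succ'] using h

end LeftMultiplication

/-- For subspaces `W`, `R` of an algebra, the sum of the subspaces `W ^ i * R * W ^ j` over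
`i + j = n`. When `W = V` and `R ⊆ V^{⊗N}`, this is the component of degree `N + n` of the two-sided
ideal of `T(V)` generated by `R`. -/
def idealPart {k A : Type*} [CommSemiring k] [Semiring A] [Algebra k A]
    (W R : Submodule k A) : ℕ → Submodule k A
  | 0 => R
  | n + 1 => W * idealPart W R n ⊔ idealPart W R n * W

section IdealPart

variable {k A : Type*} [CommSemiring k] [Semiring A] [Algebra k A] (W R : Submodule k A)

theorem idealPart_succ (n : ℕ) :
    idealPart W R (n + 1) = W * idealPart W R n ⊔ idealPart W R n * W := rfl

theorem mul_idealPart_le (n : ℕ) : W * idealPart W R n ≤ idealPart W R (n + 1) := le_sup_left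

theorem idealPart_mul_le (n : ℕ) : idealPart W R n * W ≤ idealPart W R (n + 1) := le_sup_right

theorem pow_mul_idealPart_le (d n : ℕ) : W ^ d * idealPart W R n ≤ idealPart W R (n + d) := by
  induction d with
  | zero => simp
  | succ d ih =>
    rw [pow_succ', mul_assoc]
    exact (mul_le_mul_right ih W).trans (mul_idealPart_le W R (n + d))

theorem pow_mul_le_idealPart (n : ℕ) : W ^ n * R ≤ idealPart W R n := by
  simpa [idealPart] using pow_mul_idealPart_le W R n 0

theorem idealPart_succ_eq_sup_pow_mul (n : ℕ) :
    idealPart W R (n + 1) = idealPart W R n * W ⊔ W ^ (n + 1) * R := by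
  induction n with
  | zero => simp [idealPart, sup_comm]
  | succ n ih =>
    have hle : W * (idealPart W R n * W) ≤ idealPart W R (n + 1) * W := by
      rw [← mul_assoc]
      exact mul_le_mul_left (mul_idealPart_le W R n) W
    have hmul : W * idealPart W R (n + 1) = W * (idealPart W R n * W) ⊔ W ^ (n + 1 + 1) * R := by
      rw [ih, Submodule.mul_sup, ← mul_assoc W (W ^ (n + 1)), ← pow_succ']
    rw [idealPart_succ W R (n + 1), hmul, sup_right_comm, sup_eq_right.2 hle]

theorem iSup_pow_mul_mul_pow (n : ℕ) :
    ⨆ i ∈ Finset.range (n + 1), W ^ i * R * W ^ (n + 1 - i) = idealPart W R n * W := by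
  induction n with
  | zero => simp [idealPart]
  | succ n ih =>
    have hstep : ⨆ i ∈ Finset.range (n + 1), W ^ i * R * W ^ (n + 1 + 1 - i) =
        (⨆ i ∈ Finset.range (n + 1), W ^ i * R * W ^ (n + 1 - i)) * W := by
      simp only [Submodule.iSup_mul]
      refine iSup_congr fun i => iSup_congr fun hi => ?_
      rw [Nat.succ_sub (Finset.mem_range.1 hi).le, pow_succ, mul_assoc, mul_assoc, mul_assoc]
    rw [Finset.range_add_one (n := n + 1), Finset.iSup_insert, hstep, ih,
      idealPart_succ_eq_sup_pow_mul, Submodule.sup_mul, sup_comm]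
    simp

theorem map_mul_of_map_mul_rev {A' : Type*} [Semiring A'] [Algebra k A']
    (f : A →ₗ[k] A') (hf : ∀ x y, f (x * y) = f y * f x) (X Y : Submodule k A) :
    (X * Y).map f = Y.map f * X.map f := by
  refine le_antisymm (Submodule.map_le_iff_le_comap.2 (Submodule.mul_le.2 fun x hx y hy => ?_))
    (Submodule.mul_le.2 ?_)
  · rw [Submodule.mem_comap, hf]
    exact Submodule.mul_mem_mul ⟨y, hy, rfl⟩ ⟨x, hx, rfl⟩
  · rintro _ ⟨y, hy, rfl⟩ _ ⟨x, hx, rfl⟩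
    exact ⟨x * y, Submodule.mul_mem_mul hx hy, hf x y⟩

theorem map_idealPart_of_map_mul_rev {A' : Type*} [Semiring A'] [Algebra k A']
    (f : A →ₗ[k] A') (hf : ∀ x y, f (x * y) = f y * f x) (n : ℕ) :
    (idealPart W R n).map f = idealPart (W.map f) (R.map f) n := by
  induction n with
  | zero => rfl
  | succ n ih =>
    rw [idealPart_succ, idealPart_succ, Submodule.map_sup, map_mul_of_map_mul_rev f hf,
      map_mul_of_map_mul_rev f hf, ih, sup_comm]

end IdealPart

section ExtraCondition

open TensorAlgebra

/-- A form of the extra condition for `R ⊆ V^{⊗(n+2)}` that is visibly invariant under reversal of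
tensors: if `I` is the ideal generated by `R`, then `I V ∩ V I = V I V` in the degrees from `n + 4`
to `2 n + 3`. -/
def SymmExtraCondition {k A : Type*} [CommSemiring k] [Semiring A] [Algebra k A]
    (W R : Submodule k A) (n : ℕ) : Prop :=
  ∀ j < n, idealPart W R (j + 1) * W ⊓ W * idealPart W R (j + 1) ≤ W * idealPart W R j * W

theorem symmExtraCondition_map_iff {k A : Type*} [CommSemiring k] [Semiring A] [Algebra k A]
    (W R : Submodule k A) (n : ℕ) (τ : A ≃ₗ[k] A) (hτ : ∀ x y, τ (x * y) = τ y * τ x)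
    (hW : W.map τ.toLinearMap = W) :
    SymmExtraCondition W (R.map τ.toLinearMap) n ↔ SymmExtraCondition W R n := by
  have hinj : Function.Injective τ.toLinearMap := τ.injective
  have hmul := map_mul_of_map_mul_rev (k := k) τ.toLinearMap hτ
  have hJ : ∀ j, idealPart W (R.map τ.toLinearMap) j = (idealPart W R j).map τ.toLinearMap := by
    intro j
    rw [map_idealPart_of_map_mul_rev W R τ.toLinearMap hτ, hW]
  refine forall₂_congr fun j _ => ?_
  rw [← Submodule.map_le_map_iff_of_injective hinj (idealPart W R (j + 1) * W ⊓ _),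
    Submodule.map_inf _ hinj, hmul, hmul, hmul, hmul, hW, hJ, hJ, inf_comm, mul_assoc]

variable {k V : Type*} [Field k] [AddCommGroup V] [Module k V]

theorem extraCondition_add_two_iff (n : ℕ) (R : Submodule k (TensorAlgebra k V)) :
    ExtraCondition k V (n + 2) R ↔
      LinearMap.range (ι k (M := V)) ^ (n + 1) * R ⊓
          idealPart (LinearMap.range (ι k (M := V))) R n * LinearMap.range (ι k (M := V)) ≤
        LinearMap.range (ι k (M := V)) ^ n *
          (LinearMap.range (ι k (M := V)) * R ⊓ R * LinearMap.range (ι k (M := V))) := by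
  have h₁ : n + 2 - 1 = n + 1 := rfl
  simp only [ExtraCondition, tpow, h₁, Nat.add_sub_cancel, pow_one, iSup_pow_mul_mul_pow]
  refine ⟨le_of_eq, fun h => le_antisymm h (le_inf ?_ ?_)⟩
  · rw [pow_succ, mul_assoc]
    exact mul_le_mul_right inf_le_left _
  · refine (mul_le_mul_right inf_le_right _).trans ?_
    rw [← mul_assoc]
    exact mul_le_mul_left (pow_mul_le_idealPart _ R n) _

theorem SymmExtraCondition.extraCondition [FiniteDimensional k V] {n : ℕ}
    {R : Submodule k (TensorAlgebra k V)}
    (h : SymmExtraCondition (LinearMap.range (ι k (M := V))) R n) :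
    ExtraCondition k V (n + 2) R := by
  rw [extraCondition_add_two_iff]
  set W := LinearMap.range (ι k (M := V)) with hW
  suffices hj : ∀ j ≤ n, W ^ (j + 1) * R ⊓ idealPart W R j * W ≤ W ^ j * (W * R ⊓ R * W) from
    hj n le_rfl
  intro j
  induction j with
  | zero => intro _; simp [idealPart]
  | succ j ih =>
    intro hjn
    have hle : W ^ (j + 1 + 1) * R ⊓ idealPart W R (j + 1) * W ≤ W * (idealPart W R j * W) := by
      rw [← mul_assoc]
      refine le_trans (le_inf inf_le_right (inf_le_left.trans ?_)) (h j hjn)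
      rw [pow_succ', mul_assoc]
      exact mul_le_mul_right (pow_mul_le_idealPart W R (j + 1)) W
    calc W ^ (j + 1 + 1) * R ⊓ idealPart W R (j + 1) * W
        ≤ W * (W ^ (j + 1) * R) ⊓ W * (idealPart W R j * W) :=
          le_inf (inf_le_left.trans (by rw [pow_succ', mul_assoc])) hle
      _ = W * (W ^ (j + 1) * R ⊓ idealPart W R j * W) := (range_ι_mul_inf _ _).symm
      _ ≤ W * (W ^ j * (W * R ⊓ R * W)) := mul_le_mul_right (ih (by omega)) W
      _ = W ^ (j + 1) * (W * R ⊓ R * W) := by rw [pow_succ', mul_assoc]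

theorem ExtraCondition.symmExtraCondition {n : ℕ} {R : Submodule k (TensorAlgebra k V)}
    (h : ExtraCondition k V (n + 2) R) :
    SymmExtraCondition (LinearMap.range (ι k (M := V))) R n := by
  rw [extraCondition_add_two_iff] at h
  intro j hj
  rcases subsingleton_or_nontrivial V with hV | hV
  · have hbot : LinearMap.range (ι k (M := V)) = ⊥ := by
      rw [LinearMap.range_eq_bot]
      exact Subsingleton.elim _ _
    simp [hbot]
  obtain ⟨d, rfl⟩ := Nat.exists_eq_add_of_le (Nat.succ_le_of_lt hj)
  set W := LinearMap.range (ι k (M := V)) with hW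
  have hmid : W * idealPart W R j * W ≤ idealPart W R (j + 1) * W :=
    mul_le_mul_left (mul_idealPart_le W R j) W
  have hlast : W ^ (j + 2) * R ⊓ idealPart W R (j + 1) * W ≤ W * idealPart W R j * W := by
    refine le_of_range_ι_pow_mul_le d ?_
    rw [← hW]
    calc W ^ d * (W ^ (j + 2) * R ⊓ idealPart W R (j + 1) * W)
        ≤ W ^ (j + 1 + d + 1) * R ⊓ idealPart W R (j + 1 + d) * W := by
          refine le_inf ((mul_le_mul_right inf_le_left _).trans ?_)
            ((mul_le_mul_right inf_le_right _).trans ?_)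
          · rw [← mul_assoc, ← pow_add, show d + (j + 2) = j + 1 + d + 1 by omega]
          · rw [← mul_assoc]
            exact mul_le_mul_left (pow_mul_idealPart_le W R d (j + 1)) W
      _ ≤ W ^ (j + 1 + d) * (W * R ⊓ R * W) := h
      _ ≤ W ^ (j + 1 + d) * (R * W) := mul_le_mul_right inf_le_right _
      _ = W ^ d * (W * (W ^ j * R) * W) := by
          rw [add_comm (j + 1), pow_add, pow_succ']
          simp only [mul_assoc]
      _ ≤ W ^ d * (W * idealPart W R j * W) :=
          mul_le_mul_right
            (mul_le_mul_left (mul_le_mul_right (pow_mul_le_idealPart W R j) W) W) _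
  have hsup : W * idealPart W R (j + 1) = W * idealPart W R j * W ⊔ W ^ (j + 2) * R := by
    rw [idealPart_succ_eq_sup_pow_mul, Submodule.mul_sup, ← mul_assoc, ← mul_assoc, ← pow_succ']
  rw [hsup, inf_comm, sup_inf_assoc_of_le _ hmid]
  exact sup_le le_rfl hlast

theorem extraCondition_iff_symmExtraCondition [FiniteDimensional k V] (n : ℕ)
    (R : Submodule k (TensorAlgebra k V)) :
    ExtraCondition k V (n + 2) R ↔ SymmExtraCondition (LinearMap.range (ι k (M := V))) R n :=
  ⟨ExtraCondition.symmExtraCondition, SymmExtraCondition.extraCondition⟩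

end ExtraCondition

section Reversal

open TensorAlgebra

variable {k V : Type*} [CommSemiring k] [AddCommMonoid V] [Module k V]

theorem TensorAlgebra.span_prod_ofFn_ι :
    Submodule.span k {x : TensorAlgebra k V |
      ∃ (n : ℕ) (v : Fin n → V), (List.ofFn fun i => ι k (v i)).prod = x} = ⊤ := by
  rw [eq_top_iff, ← Algebra.top_toSubmodule, ← adjoin_range_ι, Algebra.adjoin_eq_span]
  refine Submodule.span_mono fun x hx => ?_
  obtain ⟨l, hl, rfl⟩ := Submonoid.exists_list_of_mem_closure hx
  choose v hv using fun i : Fin l.length => hl (l.get i) (l.get_mem i)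
  refine ⟨l.length, v, ?_⟩
  simp only [hv, List.ofFn_get]

theorem map_mul_rev_of_map_prod_reverse (τ : TensorAlgebra k V →ₗ[k] TensorAlgebra k V)
    (hτ : ∀ (n : ℕ) (v : Fin n → V),
      τ (List.ofFn fun i => ι k (v i)).prod = ((List.ofFn fun i => ι k (v i)).reverse).prod)
    (x y : TensorAlgebra k V) : τ (x * y) = τ y * τ x := by
  let r : TensorAlgebra k V →ₐ[k] (TensorAlgebra k V)ᵐᵒᵖ :=
    lift k ((MulOpposite.opLinearEquiv k).toLinearMap ∘ₗ ι k)
  have hr : τ = (MulOpposite.opLinearEquiv k).symm.toLinearMap ∘ₗ r.toLinearMap := by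
    refine LinearMap.ext_on span_prod_ofFn_ι ?_
    rintro _ ⟨n, v, rfl⟩
    rw [hτ]
    simp [r, map_list_prod, List.map_ofFn, MulOpposite.unop_list_prod, Function.comp_def]
  simp [hr]

end Reversal

/-- let `V` be finite dimensional, `N ≥ 2`, `R ⊆ V^{⊗N}` a subspace, and
`τ` the reversal linear automorphism, determined by
`τ(v_1⊗v_2⊗⋯⊗v_n) = v_n⊗⋯⊗v_2⊗v_1` on each tensor power.  Then `R` satisfies the
extra condition if and only if `τ(R)` satisfies the extra condition. -/
theorem stmt18 (k V : Type*) [Field k] [AddCommGroup V] [Module k V]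
    [FiniteDimensional k V]
    (τ : TensorAlgebra k V ≃ₗ[k] TensorAlgebra k V)
    (hτ : ∀ (n : ℕ) (v : Fin n → V),
      τ (List.ofFn fun i => TensorAlgebra.ι k (v i)).prod
        = ((List.ofFn fun i => TensorAlgebra.ι k (v i)).reverse).prod)
    (N : ℕ) (hN : 2 ≤ N)
    (R : Submodule k (TensorAlgebra k V)) (hR : R ≤ tpow k V N) :
    ExtraCondition k V N R ↔ ExtraCondition k V N (R.map τ.toLinearMap) := by
  obtain ⟨n, rfl⟩ := Nat.exists_eq_add_of_le' hN
  have hW : (LinearMap.range (TensorAlgebra.ι k (M := V))).map τ.toLinearMap =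
      LinearMap.range (TensorAlgebra.ι k (M := V)) := by
    rw [← LinearMap.range_comp]
    congr 1
    ext v
    simpa using hτ 1 fun _ => v
  rw [extraCondition_iff_symmExtraCondition, extraCondition_iff_symmExtraCondition,
    symmExtraCondition_map_iff _ R n τ (map_mul_rev_of_map_prod_reverse τ.toLinearMap hτ) hW]
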